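/- Let φ: (0,∞) → (0,∞) be nondecreasing and regularly varying at 0 with index b ≥ 0, and if b = 0 assume additionally that ∫_0^1 φ(ξ) dξ/ξ < ∞. Set Φ(x) := x·φ(x) and ν_k := Φ(1/k) for integers k ≥ 1. Then, as n → ∞, Σ_{k=n+1}^∞ ν_k + n·ν_n ∼ c·ψ(1/n), i.e. the ratio of the two sides tends to 1, where: if b > 0 then ψ(x) := φ(x) and c := 1 + 1/b, while if b = 0 then ψ(x) := ∫_0^x φ(ξ) dξ/ξ and c := 1. -/

import Mathlib

open MeasureTheory Filter Set

/-- `φ` is regularly varying at `0` with index `b`. -/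
def RegVaryAt0 (φ : ℝ → ℝ) (b : ℝ) : Prop :=
  ∀ t : ℝ, 0 < t →
    Filter.Tendsto (fun x => φ (t * x) / φ x) (nhdsWithin 0 (Set.Ioi 0)) (nhds (t ^ b))

open Topology

theorem monotoneOn_Ioi_of_forall {φ : ℝ → ℝ}
    (hmono : ∀ x y : ℝ, 0 < x → x ≤ y → φ x ≤ φ y) : MonotoneOn φ (Ioi 0) :=
  fun x hx y _ hxy => hmono x y hx hxy

/-- A regularly varying nondecreasing function of positive index satisfies a Potter-type bound. -/
theorem RegVaryAt0.exists_potter_bound {φ : ℝ → ℝ} {b : ℝ} (hrv : RegVaryAt0 φ b) (hb : 0 < b)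
    (hpos : ∀ x : ℝ, 0 < x → 0 < φ x) (hmono : MonotoneOn φ (Ioi 0)) :
    ∃ δ > 0, ∀ x ∈ Ioc 0 δ, ∀ s ∈ Ioc (0 : ℝ) 1,
      φ (x * s) ≤ (2 * s) ^ (b / 2) * φ x := by
  set r : ℝ := (1 / 2 : ℝ) ^ (b / 2) with hr
  have hr0 : 0 < r := by positivity
  have hlt : (1 / 2 : ℝ) ^ b < r :=
    Real.rpow_lt_rpow_of_exponent_gt (by norm_num) (by norm_num) (by linarith)
  have hev := (hrv (1 / 2) (by norm_num)).eventually_lt_const hlt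
  obtain ⟨δ, hδ, hsub⟩ := (mem_nhdsGT_iff_exists_Ioc_subset).1 hev
  refine ⟨δ, hδ, fun x hx s hs => ?_⟩
  have half : ∀ y ∈ Ioc 0 δ, φ (1 / 2 * y) ≤ r * φ y := fun y hy =>
    ((div_lt_iff₀ (hpos y hy.1)).1 (hsub hy)).le
  have iter : ∀ k : ℕ, φ ((1 / 2) ^ k * x) ≤ r ^ k * φ x := by
    intro k
    induction k with
    | zero => simp
    | succ k ih =>
      have hk : (1 / 2 : ℝ) ^ k * x ∈ Ioc 0 δ := by
        refine ⟨mul_pos (by positivity) hx.1, ?_⟩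
        exact (mul_le_of_le_one_left hx.1.le (pow_le_one₀ (by norm_num) (by norm_num))).trans hx.2
      calc φ ((1 / 2) ^ (k + 1) * x) = φ (1 / 2 * ((1 / 2) ^ k * x)) := by ring_nf
        _ ≤ r * φ ((1 / 2) ^ k * x) := half _ hk
        _ ≤ r * (r ^ k * φ x) := by gcongr
        _ = r ^ (k + 1) * φ x := by ring
  obtain ⟨k, hk1, hk2⟩ :=
    exists_nat_pow_near_of_lt_one hs.1 hs.2 (by norm_num : (0 : ℝ) < 1 / 2) (by norm_num)
  have hφx := hpos x hx.1
  calc φ (x * s) ≤ φ ((1 / 2) ^ k * x) := by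
        refine hmono (mul_pos hx.1 hs.1) (mul_pos (by positivity) hx.1) ?_
        rw [mul_comm]
        exact mul_le_mul_of_nonneg_right hk2 hx.1.le
    _ ≤ r ^ k * φ x := iter k
    _ = ((1 / 2) ^ k) ^ (b / 2) * φ x := by
        rw [hr, ← Real.rpow_natCast, ← Real.rpow_natCast, ← Real.rpow_mul (by norm_num),
          ← Real.rpow_mul (by norm_num), mul_comm (b / 2)]
    _ ≤ (2 * s) ^ (b / 2) * φ x := by
        gcongr
        rw [pow_succ] at hk1
        linarith

theorem MonotoneOn.integrableOn_div_Ioc {φ : ℝ → ℝ} (hmono : MonotoneOn φ (Ioi 0))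
    {x y : ℝ} (hx : 0 < x) : IntegrableOn (fun ξ => φ ξ / ξ) (Ioc x y) := by
  have hsub : Icc x y ⊆ Ioi 0 := fun z hz => hx.trans_le hz.1
  have h := (hmono.mono hsub).integrableOn_isCompact (μ := volume) isCompact_Icc
  have hc : ContinuousOn (fun ξ : ℝ => ξ⁻¹) (Icc x y) :=
    continuousOn_inv₀.mono fun z hz => (hsub hz).ne'
  exact (h.mul_continuousOn hc isCompact_Icc).mono_set Ioc_subset_Icc_self

theorem setIntegral_Ioc_inv {x y : ℝ} (hx : 0 < x) (hxy : x ≤ y) :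
    ∫ ξ in Ioc x y, ξ⁻¹ = Real.log (y / x) := by
  rw [← intervalIntegral.integral_of_le hxy, integral_inv_of_pos hx (hx.trans_le hxy)]

theorem integrableOn_inv_Ioc {x y : ℝ} (hx : 0 < x) :
    IntegrableOn (fun ξ : ℝ => ξ⁻¹) (Ioc x y) := by
  have h : MonotoneOn (fun _ : ℝ => (1 : ℝ)) (Ioi 0) := monotoneOn_const
  simpa using h.integrableOn_div_Ioc (y := y) hx

theorem MonotoneOn.mul_log_le_setIntegral_div {φ : ℝ → ℝ} (hmono : MonotoneOn φ (Ioi 0))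
    {x y : ℝ} (hx : 0 < x) (hxy : x ≤ y) :
    φ x * Real.log (y / x) ≤ ∫ ξ in Ioc x y, φ ξ / ξ := by
  rw [← setIntegral_Ioc_inv hx hxy, ← integral_const_mul]
  refine setIntegral_mono_on ((integrableOn_inv_Ioc hx).const_mul _)
    (hmono.integrableOn_div_Ioc hx) measurableSet_Ioc fun z hz => ?_
  have hz0 : 0 < z := hx.trans hz.1
  rw [div_eq_mul_inv]
  exact mul_le_mul_of_nonneg_right (hmono hx hz0 hz.1.le) (inv_nonneg.2 hz0.le)

theorem MonotoneOn.setIntegral_div_le_mul_log {φ : ℝ → ℝ} (hmono : MonotoneOn φ (Ioi 0))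
    {x y : ℝ} (hx : 0 < x) (hxy : x ≤ y) :
    ∫ ξ in Ioc x y, φ ξ / ξ ≤ φ y * Real.log (y / x) := by
  rw [← setIntegral_Ioc_inv hx hxy, ← integral_const_mul]
  refine setIntegral_mono_on (hmono.integrableOn_div_Ioc hx)
    ((integrableOn_inv_Ioc hx).const_mul _) measurableSet_Ioc fun z hz => ?_
  have hz0 : 0 < z := hx.trans hz.1
  rw [div_eq_mul_inv]
  exact mul_le_mul_of_nonneg_right (hmono hz0 (hx.trans_le hxy) hz.2) (inv_nonneg.2 hz0.le)

theorem iUnion_Ioc_one_div_add {n : ℕ} (hn : 1 ≤ n) :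
    ⋃ k : ℕ, Ioc (1 / ((n + (k + 1) : ℕ) : ℝ)) (1 / ((n + k : ℕ) : ℝ)) = Ioc 0 (1 / (n : ℝ)) := by
  have hn0 : (0 : ℝ) < n := by exact_mod_cast hn
  ext x
  simp only [mem_iUnion, mem_Ioc]
  constructor
  · rintro ⟨k, h1, h2⟩
    refine ⟨lt_of_le_of_lt (by positivity) h1, h2.trans ?_⟩
    exact one_div_le_one_div_of_le hn0 (by push_cast; linarith [(Nat.cast_nonneg k : (0 : ℝ) ≤ k)])
  · rintro ⟨h0, h1⟩
    have hle : (n : ℝ) ≤ 1 / x := (le_one_div hn0 h0).2 h1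
    have hfl : n ≤ ⌊1 / x⌋₊ := Nat.le_floor hle
    refine ⟨⌊1 / x⌋₊ - n, ?_, ?_⟩
    · rw [← add_assoc, Nat.add_sub_cancel' hfl, one_div_lt (by positivity) h0]
      exact_mod_cast Nat.lt_floor_add_one (1 / x)
    · rw [Nat.add_sub_cancel' hfl, le_one_div h0 (by exact_mod_cast hn.trans hfl)]
      exact Nat.floor_le (by positivity)

/-- Comparison of the tail sum of `φ (1 / k) / k` with the integral of `φ ξ / ξ`. -/
theorem MonotoneOn.tsum_mem_Icc_setIntegral_div {φ : ℝ → ℝ} (hmono : MonotoneOn φ (Ioi 0))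
    (hpos : ∀ x : ℝ, 0 < x → 0 < φ x) {ν : ℕ → ℝ}
    (hν : ∀ k : ℕ, ν k = (1 / (k : ℝ)) * φ (1 / (k : ℝ))) {n : ℕ} (hn : 1 ≤ n)
    (hint : IntegrableOn (fun ξ => φ ξ / ξ) (Ioc 0 (1 / (n : ℝ)))) :
    ∑' k : ℕ, ν (n + 1 + k) ∈ Icc ((∫ ξ in Ioc 0 (1 / (n : ℝ)), φ ξ / ξ) - ν n)
      (∫ ξ in Ioc 0 (1 / (n : ℝ)), φ ξ / ξ) := by
  set J : ℕ → ℝ := fun k =>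
    ∫ ξ in Ioc (1 / ((n + (k + 1) : ℕ) : ℝ)) (1 / ((n + k : ℕ) : ℝ)), φ ξ / ξ
  have anti : Antitone fun k : ℕ => 1 / ((n + k : ℕ) : ℝ) := fun i j hij =>
    one_div_le_one_div_of_le (by exact_mod_cast (by omega : 0 < n + i))
      (by exact_mod_cast (by omega : n + i ≤ n + j))
  have hsum : HasSum J (∫ ξ in Ioc 0 (1 / (n : ℝ)), φ ξ / ξ) := by
    rw [← iUnion_Ioc_one_div_add hn] at hint ⊢
    exact hasSum_integral_iUnion (fun _ => measurableSet_Ioc)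
      anti.pairwise_disjoint_on_Ioc_succ hint
  have hm : ∀ k : ℕ, (0 : ℝ) < ((n + k : ℕ) : ℝ) := fun k => by
    exact_mod_cast (by omega : 0 < n + k)
  have hquot : ∀ k : ℕ, 1 / ((n + k : ℕ) : ℝ) / (1 / ((n + (k + 1) : ℕ) : ℝ))
      = 1 + 1 / ((n + k : ℕ) : ℝ) := fun k => by
    have h1 := (hm k).ne'
    have h2 := (hm (k + 1)).ne'
    field_simp
    push_cast
    ring
  have hlow : ∀ k, ν (n + 1 + k) ≤ J k := fun k => by
    have h := hmono.mul_log_le_setIntegral_div (one_div_pos.2 (hm (k + 1))) (anti k.le_succ)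
    refine le_trans ?_ h
    rw [hν, show n + 1 + k = n + (k + 1) by ring, mul_comm]
    refine mul_le_mul_of_nonneg_left ?_ (hpos _ (one_div_pos.2 (hm (k + 1)))).le
    have h1 := hm k
    refine le_trans (le_of_eq ?_) (Real.one_sub_inv_le_log_of_pos ?_)
    · change _ = 1 - (1 / ((n + k : ℕ) : ℝ) / (1 / ((n + (k + 1) : ℕ) : ℝ)))⁻¹
      have h2 := hm (k + 1)
      field_simp
      push_cast
      ring
    · exact div_pos (one_div_pos.2 h1) (one_div_pos.2 (hm (k + 1)))
  have hupp : ∀ k, J k ≤ ν (n + k) := fun k => by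
    have h := hmono.setIntegral_div_le_mul_log (one_div_pos.2 (hm (k + 1))) (anti k.le_succ)
    refine h.trans ?_
    rw [hν, mul_comm]
    refine mul_le_mul_of_nonneg_right ?_ (hpos _ (one_div_pos.2 (hm k))).le
    change Real.log (1 / ((n + k : ℕ) : ℝ) / (1 / ((n + (k + 1) : ℕ) : ℝ))) ≤ _
    rw [hquot]
    have h1 := one_div_pos.2 (hm k)
    linarith [Real.log_le_sub_one_of_pos (by linarith : 0 < 1 + 1 / ((n + k : ℕ) : ℝ))]
  have hν0 : ∀ k, 0 ≤ ν (n + 1 + k) := fun k => by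
    have h := hm (k + 1)
    rw [hν, show n + 1 + k = n + (k + 1) by ring]
    exact mul_nonneg (one_div_pos.2 h).le (hpos _ (one_div_pos.2 h)).le
  have htail : Summable fun k => ν (n + 1 + k) := hsum.summable.of_nonneg_of_le hν0 hlow
  have hfull : Summable fun k => ν (n + k) := by
    rw [← summable_nat_add_iff 1]
    exact htail.congr fun k => by congr 1; ring
  refine ⟨?_, ?_⟩
  · have h := hsum.summable.tsum_le_tsum hupp hfull
    rw [hsum.tsum_eq, hfull.tsum_eq_zero_add] at h
    have hshift : ∑' k, ν (n + (k + 1)) = ∑' k, ν (n + 1 + k) :=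
      tsum_congr fun k => by congr 1; ring
    rw [hshift, add_zero] at h
    linarith
  · rw [← hsum.tsum_eq]
    exact htail.tsum_le_tsum hlow hsum.summable

theorem RegVaryAt0.exists_integrableOn_div {φ : ℝ → ℝ} {b : ℝ} (hrv : RegVaryAt0 φ b) (hb : 0 < b)
    (hpos : ∀ x : ℝ, 0 < x → 0 < φ x) (hmono : MonotoneOn φ (Ioi 0)) :
    ∃ δ > 0, IntegrableOn (fun ξ => φ ξ / ξ) (Ioc 0 δ) := by
  obtain ⟨δ, hδ, hbound⟩ := hrv.exists_potter_bound hb hpos hmono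
  refine ⟨δ, hδ, ?_⟩
  have hg : IntegrableOn (fun ξ : ℝ => (2 / δ) ^ (b / 2) * φ δ * ξ ^ (b / 2 - 1)) (Ioc 0 δ) := by
    refine Integrable.const_mul ?_ _
    exact (intervalIntegral.intervalIntegrable_rpow' (by linarith)).1
  refine Integrable.mono' hg ?_ ?_
  · have h := aemeasurable_restrict_of_monotoneOn (μ := volume) measurableSet_Ioc
      (hmono.mono (Ioc_subset_Ioi_self : Ioc 0 δ ⊆ Ioi 0))
    exact (h.div aemeasurable_id).aestronglyMeasurable
  · filter_upwards [ae_restrict_mem measurableSet_Ioc] with ξ hξ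
    have hξ0 : 0 < ξ := hξ.1
    have h := hbound δ ⟨hδ, le_rfl⟩ (ξ / δ) ⟨div_pos hξ0 hδ, (div_le_one hδ).2 hξ.2⟩
    rw [mul_div_cancel₀ _ hδ.ne'] at h
    rw [Real.norm_of_nonneg (div_nonneg (hpos ξ hξ0).le hξ0.le), Real.rpow_sub_one hξ0.ne',
      ← mul_div_assoc]
    gcongr
    refine h.trans (le_of_eq ?_)
    rw [show 2 * (ξ / δ) = 2 / δ * ξ by ring, Real.mul_rpow (by positivity) hξ0.le]
    ring

/-- Karamata's theorem at `0` for positive index. -/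
theorem RegVaryAt0.tendsto_setIntegral_div_div {φ : ℝ → ℝ} {b : ℝ} (hrv : RegVaryAt0 φ b)
    (hb : 0 < b) (hpos : ∀ x : ℝ, 0 < x → 0 < φ x) (hmono : MonotoneOn φ (Ioi 0)) :
    Tendsto (fun x => (∫ ξ in Ioc 0 x, φ ξ / ξ) / φ x) (𝓝[>] 0) (𝓝 (1 / b)) := by
  obtain ⟨δ, hδ, hbound⟩ := hrv.exists_potter_bound hb hpos hmono
  have hlim : ∫ s in Ioc (0 : ℝ) 1, s ^ b / s = 1 / b := by
    have h : ∫ s in (0 : ℝ)..1, s ^ (b - 1) = 1 / b := by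
      rw [integral_rpow (Or.inl (by linarith))]
      simp [Real.zero_rpow hb.ne']
    rw [← h, intervalIntegral.integral_of_le zero_le_one]
    exact setIntegral_congr_fun measurableSet_Ioc fun s hs => (Real.rpow_sub_one hs.1.ne' b).symm
  have hscale : ∀ x > 0, ∫ s in Ioc (0 : ℝ) 1, φ (s * x) / φ x / s
      = (∫ ξ in Ioc 0 x, φ ξ / ξ) / φ x := by
    intro x hx
    rw [← intervalIntegral.integral_of_le zero_le_one, ← intervalIntegral.integral_of_le hx.le]
    have h := intervalIntegral.mul_integral_comp_mul_right (a := 0) (b := 1)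
      (f := fun ξ => φ ξ / ξ) x
    rw [zero_mul, one_mul] at h
    rw [← h, ← intervalIntegral.integral_const_mul, ← intervalIntegral.integral_div]
    refine intervalIntegral.integral_congr fun s _ => ?_
    have := hx.ne'
    field_simp
  rw [← hlim]
  refine Tendsto.congr' (eventually_nhdsWithin_of_forall hscale) ?_
  refine tendsto_integral_filter_of_dominated_convergence
    (fun s : ℝ => 2 ^ (b / 2) * s ^ (b / 2 - 1)) ?_ ?_ ?_ ?_
  · filter_upwards [self_mem_nhdsWithin] with x hx
    have hx0 : 0 < x := hx
    have hmx : MonotoneOn (fun s => φ (s * x)) (Ioc 0 1) := fun s hs t ht hst =>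
      hmono (mul_pos hs.1 hx0) (mul_pos ht.1 hx0) (mul_le_mul_of_nonneg_right hst hx0.le)
    have h := aemeasurable_restrict_of_monotoneOn (μ := volume) measurableSet_Ioc hmx
    exact ((h.div_const _).div aemeasurable_id).aestronglyMeasurable
  · filter_upwards [Ioc_mem_nhdsGT hδ] with x hx
    filter_upwards [ae_restrict_mem measurableSet_Ioc] with s hs
    have hs0 : 0 < s := hs.1
    have h := hbound x hx s hs
    rw [Real.norm_of_nonneg (div_nonneg (div_nonneg (hpos _ (mul_pos hs0 hx.1)).le
      (hpos x hx.1).le) hs0.le), Real.rpow_sub_one hs0.ne', ← mul_div_assoc]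
    gcongr
    rw [div_le_iff₀ (hpos x hx.1), ← Real.mul_rpow (by norm_num) hs0.le, mul_comm s x]
    exact h
  · exact Integrable.const_mul (intervalIntegral.intervalIntegrable_rpow' (by linarith)).1 _
  · filter_upwards [ae_restrict_mem measurableSet_Ioc] with s hs
    exact (hrv s hs.1).div_const s

/-- A nondecreasing slowly varying `φ` is negligible against the integral of `φ ξ / ξ`. -/
theorem RegVaryAt0.tendsto_div_setIntegral_div {φ : ℝ → ℝ} (hrv : RegVaryAt0 φ 0)
    (hpos : ∀ x : ℝ, 0 < x → 0 < φ x) (hmono : MonotoneOn φ (Ioi 0))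
    (hint : IntegrableOn (fun ξ => φ ξ / ξ) (Ioc 0 1)) :
    Tendsto (fun x => φ x / ∫ ξ in Ioc 0 x, φ ξ / ξ) (𝓝[>] 0) (𝓝 0) := by
  have lower : ∀ t ∈ Ioo (0 : ℝ) 1, ∀ x ∈ Ioc (0 : ℝ) 1,
      φ (t * x) * Real.log t⁻¹ ≤ ∫ ξ in Ioc 0 x, φ ξ / ξ := by
    intro t ht x hx
    have htx : 0 < t * x := mul_pos ht.1 hx.1
    have h := hmono.mul_log_le_setIntegral_div htx (mul_le_of_le_one_left hx.1.le ht.2.le)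
    rw [show x / (t * x) = t⁻¹ by have := hx.1.ne'; have := ht.1.ne'; field_simp] at h
    refine h.trans (setIntegral_mono_set (hint.mono_set (Ioc_subset_Ioc_right hx.2)) ?_
      (Ioc_subset_Ioc_left htx.le).eventuallyLE)
    filter_upwards [ae_restrict_mem measurableSet_Ioc] with ξ hξ
    exact div_nonneg (hpos ξ hξ.1).le hξ.1.le
  have hnonneg : ∀ x : ℝ, 0 ≤ ∫ ξ in Ioc 0 x, φ ξ / ξ := fun x =>
    setIntegral_nonneg measurableSet_Ioc fun ξ hξ => div_nonneg (hpos ξ hξ.1).le hξ.1.le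
  rw [Metric.tendsto_nhds]
  intro ε hε
  set t : ℝ := Real.exp (-(2 / ε)) with ht
  have ht0 : 0 < t := Real.exp_pos _
  have ht1 : t < 1 := Real.exp_lt_one_iff.2 (neg_lt_zero.2 (by positivity))
  have hlog : Real.log t⁻¹ = 2 / ε := by rw [Real.log_inv, ht, Real.log_exp, neg_neg]
  have hev := (hrv t ht0).eventually_const_lt (u := 1 / 2) (by norm_num)
  filter_upwards [hev, Ioc_mem_nhdsGT zero_lt_one] with x hx hx1
  have hφx := hpos x hx1.1
  have hl := lower t ⟨ht0, ht1⟩ x hx1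
  rw [lt_div_iff₀ hφx] at hx
  have hlt : φ x / ε < ∫ ξ in Ioc 0 x, φ ξ / ξ := by
    refine lt_of_lt_of_le ?_ hl
    rw [hlog, show φ x / ε = 1 / 2 * φ x * (2 / ε) by ring]
    exact mul_lt_mul_of_pos_right hx (by positivity)
  have hI : 0 < ∫ ξ in Ioc 0 x, φ ξ / ξ := lt_trans (by positivity) hlt
  rw [Real.dist_eq, sub_zero, abs_of_pos (div_pos hφx hI), div_lt_iff₀ hI]
  rwa [div_lt_iff₀ hε, mul_comm] at hlt

theorem tendsto_one_div_natCast_nhdsGT_zero :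
    Tendsto (fun n : ℕ => 1 / (n : ℝ)) atTop (𝓝[>] 0) := by
  refine tendsto_nhdsWithin_iff.2 ⟨tendsto_one_div_atTop_nhds_zero_nat, ?_⟩
  filter_upwards [eventually_ge_atTop 1] with n hn
  have hn0 : (0 : ℝ) < n := by exact_mod_cast hn
  exact one_div_pos.2 hn0

/-- For `φ` positive, nondecreasing and regularly varying at `0` with index `b ≥ 0`
(with `∫_0^1 φ(ξ) dξ/ξ < ∞` when `b = 0`) and `ν_k = (1/k)·φ(1/k)`, one has
`Σ_{k>n} ν_k + n ν_n ∼ c·ψ(1/n)`, where `ψ = φ`, `c = 1 + 1/b` if `b > 0`, and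
`ψ(x) = ∫_0^x φ(ξ) dξ/ξ`, `c = 1` if `b = 0`. -/
theorem tail_sum_asymptotics_of_reg_varying
    (φ : ℝ → ℝ) (b : ℝ) (hb : 0 ≤ b)
    (hφpos : ∀ x : ℝ, 0 < x → 0 < φ x)
    (hφmono : ∀ x y : ℝ, 0 < x → x ≤ y → φ x ≤ φ y)
    (hφrv : RegVaryAt0 φ b)
    (hφint : b = 0 → IntegrableOn (fun ξ => φ ξ / ξ) (Set.Ioc (0 : ℝ) 1))
    (ν : ℕ → ℝ) (hν : ∀ k : ℕ, ν k = (1 / (k : ℝ)) * φ (1 / (k : ℝ))) :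
    (0 < b →
      Filter.Tendsto
        (fun n : ℕ => ((∑' k : ℕ, ν (n + 1 + k)) + n * ν n) / ((1 + 1 / b) * φ (1 / (n : ℝ))))
        Filter.atTop (nhds 1)) ∧
    (b = 0 →
      Filter.Tendsto
        (fun n : ℕ => ((∑' k : ℕ, ν (n + 1 + k)) + n * ν n)
            / ∫ ξ in Set.Ioc (0 : ℝ) (1 / (n : ℝ)), φ ξ / ξ)
        Filter.atTop (nhds 1)) := by
  have hmono := monotoneOn_Ioi_of_forall hφmono
  have hnν : ∀ n : ℕ, 1 ≤ n → n * ν n = φ (1 / (n : ℝ)) := fun n hn => by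
    have hn0 : (n : ℝ) ≠ 0 := by exact_mod_cast (by omega : n ≠ 0)
    rw [hν, ← mul_assoc, mul_one_div_cancel hn0, one_mul]
  refine ⟨fun hb0 => ?_, fun hb0 => ?_⟩
  · obtain ⟨δ, hδ, hint⟩ := hφrv.exists_integrableOn_div hb0 hφpos hmono
    have hK := (hφrv.tendsto_setIntegral_div_div hb0 hφpos hmono).comp
      tendsto_one_div_natCast_nhdsGT_zero
    have hc : 0 < 1 + 1 / b := by positivity
    have hupper := (hK.add_const 1).div_const (1 + 1 / b)
    have hlower := ((hK.add_const 1).sub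
      (tendsto_one_div_atTop_nhds_zero_nat (𝕜 := ℝ))).div_const (1 + 1 / b)
    rw [sub_zero] at hlower
    rw [add_comm (1 / b), div_self hc.ne'] at hupper hlower
    have hsmall := tendsto_one_div_natCast_nhdsGT_zero.eventually (Ioc_mem_nhdsGT hδ)
    refine tendsto_of_tendsto_of_tendsto_of_le_of_le' hlower hupper ?_ ?_
    all_goals
      filter_upwards [hsmall, eventually_ge_atTop 1] with n hnδ hn
      have hT := hmono.tsum_mem_Icc_setIntegral_div hφpos hν hn
        (hint.mono_set (Ioc_subset_Ioc_right hnδ.2))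
      have hφn := hφpos _ hnδ.1
      rw [hnν n hn, mul_comm, ← div_div]
      refine div_le_div_of_nonneg_right ?_ hc.le
      simp only [Function.comp_apply]
    · rw [le_div_iff₀ hφn, sub_mul, add_mul, div_mul_cancel₀ _ hφn.ne', ← hν]
      linarith [hT.1]
    · rw [div_le_iff₀ hφn, add_mul, div_mul_cancel₀ _ hφn.ne']
      linarith [hT.2]
  · subst hb0
    have hint := hφint rfl
    have hK := (hφrv.tendsto_div_setIntegral_div hφpos hmono hint).comp
      tendsto_one_div_natCast_nhdsGT_zero
    have hupper := hK.const_add 1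
    rw [add_zero] at hupper
    refine tendsto_of_tendsto_of_tendsto_of_le_of_le' tendsto_const_nhds hupper ?_ ?_
    all_goals
      filter_upwards [eventually_ge_atTop 1] with n hn
      have hn1 : (1 : ℝ) ≤ n := by exact_mod_cast hn
      have hx : 0 < 1 / (n : ℝ) := by positivity
      have hx1 : 1 / (n : ℝ) ≤ 1 := (div_le_one (by linarith)).2 hn1
      have hintn := hint.mono_set (Ioc_subset_Ioc_right hx1)
      have hT := hmono.tsum_mem_Icc_setIntegral_div hφpos hν hn hintn
      have hφn := hφpos _ hx
      have hI : 0 < ∫ ξ in Ioc 0 (1 / (n : ℝ)), φ ξ / ξ := by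
        rw [← intervalIntegral.integral_of_le hx.le]
        exact intervalIntegral.intervalIntegral_pos_of_pos_on
          ((intervalIntegrable_iff_integrableOn_Ioc_of_le hx.le).2 hintn)
          (fun ξ hξ => div_pos (hφpos ξ hξ.1) hξ.1) hx
      rw [hnν n hn]
    · have hνn : ν n ≤ φ (1 / (n : ℝ)) := by
        rw [hν]
        exact mul_le_of_le_one_left hφn.le hx1
      rw [le_div_iff₀ hI]
      linarith [hT.1]
    · simp only [Function.comp_apply]
      rw [div_le_iff₀ hI, add_mul, div_mul_cancel₀ _ hI.ne']
      linarith [hT.2]
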